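/- arXiv:1208.2184 — 2 statements merged into one kernel-verified Lean document; each statement's English description precedes it below -/
import Mathlib

section
/- Let C and D be additive (preadditive with finite biproducts) categories and F : C → D a functor. Then the comma category (F ↓ D) is additive if and only if F is an additive functor. -/
open CategoryTheory CategoryTheory.Limits

namespace CategoryTheory

/-- A functor between preadditive categories which preserves finite products is additive. -/
lemma Functor.additive_of_preservesFiniteProducts {A : Type*} {B : Type*} [Category* A]
    [Category* B] [Preadditive A] [Preadditive B] [HasFiniteProducts A] (G : A ⥤ B)
    [PreservesFiniteProducts G] [HasZeroObject B] : G.Additive := by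
  have : HasZeroObject A := hasZeroObject_of_hasTerminal_object
  exact G.additive_of_preserves_binary_products

namespace Comma

section Limits

universe w w'

variable {J : Type w} [Category.{w'} J] {A B T : Type*} [Category* A] [Category* B] [Category* T]
  {L : A ⥤ T} {R : B ⥤ T} [HasLimitsOfShape J A] [HasLimitsOfShape J B] [PreservesLimitsOfShape J R]

lemma preservesLimitsOfShape_fst : PreservesLimitsOfShape J (Comma.fst L R) where
  preservesLimit :=
    preservesLimit_of_preserves_limit_cone
      (coneOfPreservesIsLimit _ (limit.isLimit _) (limit.isLimit _)) (limit.isLimit _)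

lemma preservesLimitsOfShape_snd : PreservesLimitsOfShape J (Comma.snd L R) where
  preservesLimit :=
    preservesLimit_of_preserves_limit_cone
      (coneOfPreservesIsLimit _ (limit.isLimit _) (limit.isLimit _)) (limit.isLimit _)

end Limits

section FiniteProducts

variable {A B T : Type*} [Category* A] [Category* B] [Category* T] (L : A ⥤ T) (R : B ⥤ T)
  [HasFiniteProducts A] [HasFiniteProducts B] [PreservesFiniteProducts R]

lemma hasFiniteProducts : HasFiniteProducts (Comma L R) where
  out _ := inferInstance

lemma preservesFiniteProducts_fst : PreservesFiniteProducts (Comma.fst L R) where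
  preserves _ := preservesLimitsOfShape_fst

lemma preservesFiniteProducts_snd : PreservesFiniteProducts (Comma.snd L R) where
  preserves _ := preservesLimitsOfShape_snd

end FiniteProducts

/-- The functor sending `X` to `𝟙 (F.obj X)`, viewed as an object of `Comma F (𝟭 D)`. -/
def ofId {C D : Type*} [Category* C] [Category* D] (F : C ⥤ D) : C ⥤ Comma F (𝟭 D) where
  obj X := { left := X, right := F.obj X, hom := 𝟙 (F.obj X) }
  map f := { left := f, right := F.map f }

/-- A morphism out of `(ofId F).obj X` is determined by its left component. -/
lemma ofId_hom_ext {C D : Type*} [Category* C] [Category* D] {F : C ⥤ D} {X : C}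
    {Y : Comma F (𝟭 D)} {f g : (ofId F).obj X ⟶ Y} (h : f.left = g.left) : f = g := by
  have hf := f.w
  have hg := g.w
  simp only [ofId, Functor.id_obj, Functor.id_map, Category.id_comp] at hf hg
  exact CommaMorphism.ext h (by rw [← hf, ← hg, h])

end Comma

/-- If the comma category `Comma F (𝟭 D)` carries any preadditive structure, then `F` is
additive. -/
lemma Functor.additive_of_preadditive_comma {C D : Type*} [Category* C] [Category* D]
    [Preadditive C] [Preadditive D] [HasFiniteProducts C] [HasFiniteProducts D] (F : C ⥤ D)
    [Preadditive (Comma F (𝟭 D))] : F.Additive := by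
  have := Comma.hasFiniteProducts F (𝟭 D)
  have := Comma.preservesFiniteProducts_fst F (𝟭 D)
  have := Comma.preservesFiniteProducts_snd F (𝟭 D)
  have : HasZeroObject C := hasZeroObject_of_hasTerminal_object
  have : HasZeroObject D := hasZeroObject_of_hasTerminal_object
  have : (Comma.fst F (𝟭 D)).Additive := additive_of_preservesFiniteProducts _
  have : (Comma.snd F (𝟭 D)).Additive := additive_of_preservesFiniteProducts _
  have : (Comma.ofId F).Additive :=
    ⟨fun {_ _ f g} ↦ Comma.ofId_hom_ext
      ((Comma.fst F (𝟭 D)).map_add (f := (Comma.ofId F).map f) (g := (Comma.ofId F).map g)).symm⟩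
  exact inferInstanceAs (Comma.ofId F ⋙ Comma.snd F (𝟭 D)).Additive

end CategoryTheory

/-- For additive categories `C`, `D` and a functor `F : C ⥤ D`, the comma category
`(F ↓ D)` is additive (preadditive with finite biproducts) if and only if `F` is additive. -/
theorem comma_additive_iff_functor_additive {C : Type u₁} {D : Type u₂}
    [Category.{v₁} C] [Category.{v₂} D]
    [Preadditive C] [Preadditive D] [HasFiniteBiproducts C] [HasFiniteBiproducts D]
    (F : C ⥤ D) :
    (∃ p : Preadditive (Comma F (𝟭 D)),
      @HasFiniteBiproducts (Comma F (𝟭 D)) _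
        (@Preadditive.preadditiveHasZeroMorphisms _ _ p)) ↔ F.Additive := by
  constructor
  · rintro ⟨_, _⟩
    exact F.additive_of_preadditive_comma
  · intro _
    have := Comma.hasFiniteProducts F (𝟭 D)
    exact ⟨inferInstance, HasFiniteBiproducts.of_hasFiniteProducts⟩
end

section
/- For any abelian group A, the quadratic tensor product A ⊗^q ℤ^Γ with the quadratic module ℤ^Γ = (ℤ →1 ℤ →2 ℤ) is naturally isomorphic to Whitehead's universal quadratic functor Γ(A). -/
open FreeAbelianGroup

/-- Generators of the quadratic tensor product `A ⊗^q M`: symbols `a ⊗ m` and `[a,b] ⊗ n`. -/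
abbrev QGen (A Me Mee : Type u) : Type u := Sum (A × Me) (A × A × Mee)

/-- Relations of the quadratic tensor product `A ⊗^q M` for a quadratic module
`M = (Me →H Mee →P Me)`, with `T = HP − 1`. -/
def qRels (A Me Mee : Type u) [AddCommGroup A] [AddCommGroup Me] [AddCommGroup Mee]
    (H : Me →+ Mee) (P : Mee →+ Me) : Set (FreeAbelianGroup (QGen A Me Mee)) :=
  {x | (∃ a b m, x = of (.inl (a + b, m)) - of (.inl (a, m)) - of (.inl (b, m)) -
          of (.inr (a, b, H m))) ∨
       (∃ a m m', x = of (.inl (a, m + m')) - of (.inl (a, m)) - of (.inl (a, m'))) ∨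
       (∃ a n, x = of (.inr (a, a, n)) - of (.inl (a, P n))) ∨
       (∃ a b n, x = of (.inr (a, b, n)) - of (.inr (b, a, H (P n) - n))) ∨
       (∃ a a' b n, x = of (.inr (a + a', b, n)) - of (.inr (a, b, n)) - of (.inr (a', b, n))) ∨
       (∃ a b b' n, x = of (.inr (a, b + b', n)) - of (.inr (a, b, n)) - of (.inr (a, b', n))) ∨
       (∃ a b n n', x = of (.inr (a, b, n + n')) - of (.inr (a, b, n)) - of (.inr (a, b, n')))}

/-- The quadratic tensor product `A ⊗^q M`, presented by generators and relations. -/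
def QTensor (A Me Mee : Type u) [AddCommGroup A] [AddCommGroup Me] [AddCommGroup Mee]
    (H : Me →+ Mee) (P : Mee →+ Me) : Type u :=
  FreeAbelianGroup (QGen A Me Mee) ⧸ AddSubgroup.closure (qRels A Me Mee H P)

instance (A Me Mee : Type u) [AddCommGroup A] [AddCommGroup Me] [AddCommGroup Mee]
    (H : Me →+ Mee) (P : Mee →+ Me) : AddCommGroup (QTensor A Me Mee H P) :=
  QuotientAddGroup.Quotient.addCommGroup _

/-- Relations of Whitehead's universal quadratic functor `Γ(A)`. -/
def gammaRels (A : Type u) [AddCommGroup A] : Set (FreeAbelianGroup A) :=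
  {x | (∃ a, x = of (-a) - of a) ∨
       (∃ a b c, x = of (a + b + c) - of (a + b) - of (b + c) - of (a + c) +
          of a + of b + of c)}

/-- Whitehead's universal quadratic functor `Γ(A)`, presented by generators and relations. -/
def WhiteheadGamma (A : Type u) [AddCommGroup A] : Type u :=
  FreeAbelianGroup A ⧸ AddSubgroup.closure (gammaRels A)

instance (A : Type u) [AddCommGroup A] : AddCommGroup (WhiteheadGamma A) :=
  QuotientAddGroup.Quotient.addCommGroup _

namespace WhiteheadGamma

variable {A : Type u} [AddCommGroup A]

/-- The universal quadratic map `γ : A → Γ(A)`. -/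
def gamma (a : A) : WhiteheadGamma A := QuotientAddGroup.mk (of a)

theorem gamma_neg (a : A) : gamma (-a) = gamma a := by
  rw [← sub_eq_zero]
  exact (QuotientAddGroup.eq_zero_iff _).2
    (AddSubgroup.subset_closure (Or.inl ⟨a, rfl⟩))

theorem gamma_add_add (a b c : A) :
    gamma (a + b + c) = gamma (a + b) + gamma (b + c) + gamma (a + c)
      - gamma a - gamma b - gamma c := by
  have h : gamma (a + b + c) - gamma (a + b) - gamma (b + c) - gamma (a + c) +
      gamma a + gamma b + gamma c = 0 :=
    (QuotientAddGroup.eq_zero_iff _).2 (AddSubgroup.subset_closure (Or.inr ⟨a, b, c, rfl⟩))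
  rw [← sub_eq_zero, ← h]
  abel

@[simp]
theorem gamma_zero : gamma (0 : A) = 0 := by
  have h := gamma_add_add (0 : A) 0 0
  simp only [add_zero] at h
  rw [h]
  abel

theorem gamma_add_self (a : A) : gamma (a + a) = (4 : ℤ) • gamma a := by
  have h := gamma_add_add a a (-a)
  simp only [add_neg_cancel, add_neg_cancel_right, gamma_zero, gamma_neg] at h
  rw [← sub_eq_zero] at h ⊢
  rw [← neg_eq_zero, ← h]
  abel

/-- The homomorphism out of `Γ(A)` induced by a quadratic map. -/
def lift {G : Type v} [AddCommGroup G] (f : A → G) (hneg : ∀ a, f (-a) = f a)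
    (hadd : ∀ a b c, f (a + b + c) - f (a + b) - f (b + c) - f (a + c) + f a + f b + f c = 0) :
    WhiteheadGamma A →+ G :=
  QuotientAddGroup.lift _ (FreeAbelianGroup.lift f) <| by
    rw [AddSubgroup.closure_le]
    rintro x (⟨a, rfl⟩ | ⟨a, b, c, rfl⟩)
    · simp [hneg]
    · simpa using hadd a b c

theorem lift_gamma {G : Type v} [AddCommGroup G] (f : A → G) (hneg : ∀ a, f (-a) = f a)
    (hadd : ∀ a b c, f (a + b + c) - f (a + b) - f (b + c) - f (a + c) + f a + f b + f c = 0)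
    (a : A) : lift f hneg hadd (gamma a) = f a :=
  FreeAbelianGroup.lift_apply_of f a

theorem hom_ext {G : Type v} [AddCommGroup G] {f g : WhiteheadGamma A →+ G}
    (h : ∀ a, f (gamma a) = g (gamma a)) : f = g :=
  QuotientAddGroup.addMonoidHom_ext _ (FreeAbelianGroup.lift_ext _ _ h)

end WhiteheadGamma

namespace QTensor

section Relations

variable {A Me Mee : Type u} [AddCommGroup A] [AddCommGroup Me] [AddCommGroup Mee]
  (H : Me →+ Mee) (P : Mee →+ Me)

/-- The symbol `a ⊗ m`. -/
def tmul (a : A) (m : Me) : QTensor A Me Mee H P := QuotientAddGroup.mk (of (.inl (a, m)))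

/-- The symbol `[a,b] ⊗ n`. -/
def bracket (a b : A) (n : Mee) : QTensor A Me Mee H P :=
  QuotientAddGroup.mk (of (.inr (a, b, n)))

variable {H P}

theorem mk_eq_zero {x : FreeAbelianGroup (QGen A Me Mee)} (hx : x ∈ qRels A Me Mee H P) :
    (QuotientAddGroup.mk x : QTensor A Me Mee H P) = 0 :=
  (QuotientAddGroup.eq_zero_iff _).2 (AddSubgroup.subset_closure hx)

theorem add_tmul (a b : A) (m : Me) :
    tmul H P (a + b) m = tmul H P a m + tmul H P b m + bracket H P a b (H m) := by
  rw [← sub_eq_zero, ← sub_sub, ← sub_sub]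
  exact mk_eq_zero (Or.inl ⟨a, b, m, rfl⟩)

theorem tmul_add (a : A) (m m' : Me) :
    tmul H P a (m + m') = tmul H P a m + tmul H P a m' := by
  rw [← sub_eq_zero, ← sub_sub]
  exact mk_eq_zero (Or.inr <| Or.inl ⟨a, m, m', rfl⟩)

theorem bracket_self (a : A) (n : Mee) : bracket H P a a n = tmul H P a (P n) := by
  rw [← sub_eq_zero]
  exact mk_eq_zero (Or.inr <| Or.inr <| Or.inl ⟨a, n, rfl⟩)

theorem bracket_add_left (a a' b : A) (n : Mee) :
    bracket H P (a + a') b n = bracket H P a b n + bracket H P a' b n := by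
  rw [← sub_eq_zero, ← sub_sub]
  exact mk_eq_zero (Or.inr <| Or.inr <| Or.inr <| Or.inr <| Or.inl ⟨a, a', b, n, rfl⟩)

theorem bracket_add_right (a b b' : A) (n : Mee) :
    bracket H P a (b + b') n = bracket H P a b n + bracket H P a b' n := by
  rw [← sub_eq_zero, ← sub_sub]
  exact mk_eq_zero (Or.inr <| Or.inr <| Or.inr <| Or.inr <| Or.inr <| Or.inl ⟨a, b, b', n, rfl⟩)

theorem bracket_add (a b : A) (n n' : Mee) :
    bracket H P a b (n + n') = bracket H P a b n + bracket H P a b n' := by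
  rw [← sub_eq_zero, ← sub_sub]
  exact mk_eq_zero (Or.inr <| Or.inr <| Or.inr <| Or.inr <| Or.inr <| Or.inr ⟨a, b, n, n', rfl⟩)

theorem hom_ext {G : Type v} [AddCommGroup G] {f g : QTensor A Me Mee H P →+ G}
    (htmul : ∀ a m, f (tmul H P a m) = g (tmul H P a m))
    (hbracket : ∀ a b n, f (bracket H P a b n) = g (bracket H P a b n)) : f = g :=
  QuotientAddGroup.addMonoidHom_ext _ <| FreeAbelianGroup.lift_ext _ _ fun x => by
    rcases x with ⟨a, m⟩ | ⟨a, b, n⟩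
    · exact htmul a m
    · exact hbracket a b n

theorem zsmul_tmul (k : ℤ) (a : A) (m : Me) : tmul H P a (k • m) = k • tmul H P a m :=
  map_zsmul (AddMonoidHom.mk' (tmul H P a) (tmul_add a)) k m

theorem zsmul_bracket (k : ℤ) (a b : A) (n : Mee) :
    bracket H P a b (k • n) = k • bracket H P a b n :=
  map_zsmul (AddMonoidHom.mk' (bracket H P a b) (bracket_add a b)) k n

theorem bracket_neg_right (a b : A) (n : Mee) :
    bracket H P a (-b) n = -bracket H P a b n :=
  map_neg (AddMonoidHom.mk' (fun b => bracket H P a b n) fun b b' => bracket_add_right a b b' n) b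

theorem bracket_zero_right (a : A) (n : Mee) : bracket H P a 0 n = 0 :=
  map_zero (AddMonoidHom.mk' (fun b => bracket H P a b n) fun b b' => bracket_add_right a b b' n)

theorem zero_tmul (m : Me) : tmul H P (0 : A) m = 0 := by
  simpa [bracket_zero_right] using add_tmul (H := H) (P := P) (0 : A) 0 m

theorem neg_tmul (a : A) (m : Me) :
    tmul H P (-a) m = tmul H P a (P (H m)) - tmul H P a m := by
  have h := add_tmul (H := H) (P := P) a (-a) m
  rw [add_neg_cancel, zero_tmul, bracket_neg_right, bracket_self] at h
  rw [← sub_eq_zero, h]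
  abel

end Relations

open WhiteheadGamma

variable (A : Type) [AddCommGroup A]

/-- The quadratic tensor product `A ⊗^q ℤ^Γ`. -/
abbrev ZGamma : Type := QTensor A ℤ ℤ (AddMonoidHom.id ℤ) (AddMonoidHom.mulLeft 2)

/-- The homomorphism `A ⊗^q ℤ^Γ → Γ(A)` with `a ⊗ m ↦ m γ(a)` and
`[a,b] ⊗ n ↦ n (γ(a+b) - γ(a) - γ(b))`. -/
def toGamma : ZGamma A →+ WhiteheadGamma A :=
  QuotientAddGroup.lift _ (FreeAbelianGroup.lift (Sum.elim (fun x => x.2 • gamma x.1)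
      fun x => x.2.2 • (gamma (x.1 + x.2.1) - gamma x.1 - gamma x.2.1))) <| by
    rw [AddSubgroup.closure_le]
    rintro x (⟨a, b, m, rfl⟩ | ⟨a, m, m', rfl⟩ | ⟨a, n, rfl⟩ | ⟨a, b, n, rfl⟩ |
      ⟨a, a', b, n, rfl⟩ | ⟨a, b, b', n, rfl⟩ | ⟨a, b, n, n', rfl⟩) <;>
    simp only [SetLike.mem_coe, AddMonoidHom.mem_ker, map_sub, FreeAbelianGroup.lift_apply_of,
      Sum.elim_inl, Sum.elim_inr, AddMonoidHom.id_apply, AddMonoidHom.coe_mulLeft]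
    · module
    · module
    · rw [gamma_add_self]
      module
    · rw [add_comm b a]
      module
    · rw [gamma_add_add]
      module
    · rw [← add_assoc, gamma_add_add]
      module
    · module

variable {A}

theorem toGamma_tmul (a : A) (m : ℤ) : toGamma A (tmul _ _ a m) = m • gamma a :=
  FreeAbelianGroup.lift_apply_of _ _

theorem toGamma_bracket (a b : A) (n : ℤ) :
    toGamma A (bracket _ _ a b n) = n • (gamma (a + b) - gamma a - gamma b) :=
  FreeAbelianGroup.lift_apply_of _ _

variable (A)

/-- The homomorphism `Γ(A) → A ⊗^q ℤ^Γ` with `γ(a) ↦ a ⊗ 1`. -/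
def ofGamma : WhiteheadGamma A →+ ZGamma A :=
  WhiteheadGamma.lift (fun a => tmul _ _ a 1)
    (fun a => by
      rw [neg_tmul, sub_eq_iff_eq_add, ← tmul_add]
      rfl)
    (fun a b c => by
      simp only [add_tmul, bracket_add_left]
      abel)

/-- The isomorphism `A ⊗^q ℤ^Γ ≃ Γ(A)`. -/
def equivGamma : ZGamma A ≃+ WhiteheadGamma A :=
  AddMonoidHom.toAddEquiv (toGamma A) (ofGamma A)
    (hom_ext
      (fun a m => by
        simp only [AddMonoidHom.comp_apply, toGamma_tmul, map_zsmul, ofGamma, lift_gamma,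
          ← zsmul_tmul, smul_eq_mul, mul_one, AddMonoidHom.id_apply])
      (fun a b n => by
        simp only [AddMonoidHom.comp_apply, toGamma_bracket, map_zsmul, map_sub, ofGamma,
          lift_gamma, add_tmul, sub_sub, map_add, add_sub_cancel_left, ← zsmul_bracket, smul_eq_mul,
          mul_one, AddMonoidHom.id_apply]))
    (WhiteheadGamma.hom_ext fun a => by
      simp only [AddMonoidHom.comp_apply, ofGamma, lift_gamma, toGamma_tmul, one_smul,
        AddMonoidHom.id_apply])

end QTensor

/-- For any abelian group `A`, the quadratic tensor product `A ⊗^q ℤ^Γ` with the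
quadratic module `ℤ^Γ = (ℤ →1 ℤ →2 ℤ)` is (naturally) isomorphic to Whitehead's universal
quadratic functor `Γ(A)`, via `a ⊗ m ↦ m·γ(a)` and `[a,b] ⊗ n ↦ n·(γ(a+b) − γ(a) − γ(b))`. -/
theorem qtensor_zgamma_iso_whitehead_gamma (A : Type) [AddCommGroup A] :
    ∃ e : QTensor A ℤ ℤ (AddMonoidHom.id ℤ) (AddMonoidHom.mulLeft 2) ≃+ WhiteheadGamma A,
      (∀ (a : A) (m : ℤ),
        e (QuotientAddGroup.mk (of (.inl (a, m)))) =
          m • (QuotientAddGroup.mk (of a) : WhiteheadGamma A)) ∧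
      (∀ (a b : A) (n : ℤ),
        e (QuotientAddGroup.mk (of (.inr (a, b, n)))) =
          n • ((QuotientAddGroup.mk (of (a + b)) : WhiteheadGamma A) -
            QuotientAddGroup.mk (of a) - QuotientAddGroup.mk (of b))) := by
  exact ⟨QTensor.equivGamma A, QTensor.toGamma_tmul, QTensor.toGamma_bracket⟩
end
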